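/- Let C be a q-ary Singleton-optimal [n,k,d;r]-locally repairable code with disjoint recovery sets such that r < k and r² + 2r < n − d, and let b be the integer with 1 ≤ b ≤ r+1 and d ≡ b (mod r+1). Then there exists a q-ary Singleton-optimal [n−d+b, k, b; r]-locally repairable code with disjoint recovery sets. -/

import Mathlib

open Finset

section Defs

variable {F : Type*} [Field F] [Fintype F] [DecidableEq F]

/-- The minimum (Hamming) distance of the linear code `C` is exactly `d`. -/
def MinDistIs {n : ℕ} (C : Submodule F (Fin n → F)) (d : ℕ) : Prop :=
  (∃ c ∈ C, c ≠ 0 ∧ hammingNorm c = d) ∧ ∀ c ∈ C, c ≠ 0 → d ≤ hammingNorm c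

/-- `R` is a recovery set at coordinate `i` for the code `C`: any two codewords that agree
on all coordinates of `R` other than `i` also agree at `i`. -/
def IsRecoverySet {n : ℕ} (C : Submodule F (Fin n → F)) (i : Fin n)
    (R : Finset (Fin n)) : Prop :=
  i ∈ R ∧ ∀ u ∈ C, ∀ v ∈ C, (∀ j ∈ R, j ≠ i → u j = v j) → u i = v i

/-- The code `C` has locality `r`: every coordinate has a recovery set of size at most `r+1`. -/
def HasLocality {n : ℕ} (C : Submodule F (Fin n → F)) (r : ℕ) : Prop :=
  ∀ i : Fin n, ∃ R : Finset (Fin n), R.card ≤ r + 1 ∧ IsRecoverySet C i R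

/-- The parameters attain the Singleton-type bound for LRCs: `d = n - k - ⌈k/r⌉ + 2`. -/
def SingletonOptimalParams (n k d r : ℕ) : Prop :=
  (d : ℤ) = (n : ℤ) - (k : ℤ) - ⌈(k : ℚ) / (r : ℚ)⌉ + 2

/-- `C` is a Singleton-optimal `[n,k,d;r]`-locally repairable code over `F`. -/
def IsOptLRC {n : ℕ} (C : Submodule F (Fin n → F)) (k d r : ℕ) : Prop :=
  Module.finrank F ↥C = k ∧ MinDistIs C d ∧ HasLocality C r ∧ SingletonOptimalParams n k d r

/-- `x` belongs to the dual code of `C` (w.r.t. the standard bilinear form). -/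
def InDual {n : ℕ} (C : Submodule F (Fin n → F)) (x : Fin n → F) : Prop :=
  ∀ c ∈ C, ∑ i, x i * c i = 0

/-- `P` is a partition of the coordinates `{1,…,n}` into supports of dual codewords of
Hamming weight at most `r+1` (disjoint recovery sets). -/
def IsRecoveryPartition {n : ℕ} (C : Submodule F (Fin n → F)) (r : ℕ)
    (P : Finset (Finset (Fin n))) : Prop :=
  (∀ S ∈ P, ∃ c : Fin n → F, InDual C c ∧ c ≠ 0 ∧ hammingNorm c ≤ r + 1 ∧
      (Finset.univ.filter fun i => c i ≠ 0) = S) ∧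
  (∀ S ∈ P, ∀ T ∈ P, S ≠ T → Disjoint S T) ∧
  (∀ i : Fin n, ∃ S ∈ P, i ∈ S)

/-- `C` has disjoint recovery sets. -/
def HasDisjointRecoverySets {n : ℕ} (C : Submodule F (Fin n → F)) (r : ℕ) : Prop :=
  ∃ P : Finset (Finset (Fin n)), IsRecoveryPartition C r P

/-- The Main MDS Conjecture over `F`: every nontrivial MDS code over `F`
(dimension `κ` with `2 ≤ κ ≤ m - 2`, minimum distance `δ = m - κ + 1`) has
length `m` at most `q + 2`, where `q = |F|`. -/
def MDSConjecture (F : Type*) [Field F] [Fintype F] [DecidableEq F] : Prop :=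
  ∀ (m κ δ : ℕ) (D : Submodule F (Fin m → F)),
    Module.finrank F ↥D = κ → MinDistIs D δ → δ + κ = m + 1 →
    2 ≤ κ → κ + 2 ≤ m → m ≤ Fintype.card F + 2

end Defs


section Helpers

variable {F : Type*} [Field F] [Fintype F] [DecidableEq F]

lemma aux_exists_vanish {n : ℕ} (C : Submodule F (Fin n → F)) (W : Finset (Fin n))
    (hW : W.card < Module.finrank F ↥C) : ∃ c ∈ C, c ≠ 0 ∧ ∀ i ∈ W, c i = 0 := by
  let f : (Fin n → F) →ₗ[F] (W → F) := LinearMap.funLeft F F (fun i : W => (i : Fin n))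
  have hk : LinearMap.ker (f.domRestrict C) ≠ ⊥ := by
    apply LinearMap.ker_ne_bot_of_finrank_lt
    simpa using hW
  obtain ⟨x, hx, hx0⟩ := Submodule.exists_mem_ne_zero_of_ne_bot hk
  refine ⟨x, x.2, ?_, ?_⟩
  · intro h
    exact hx0 (Subtype.ext h)
  · intro i hi
    have := congrFun (LinearMap.mem_ker.1 hx) ⟨i, hi⟩
    simpa [f, LinearMap.funLeft] using this

lemma aux_recover {n r : ℕ} {C : Submodule F (Fin n → F)} {P : Finset (Finset (Fin n))}
    (hP : IsRecoveryPartition C r P) {S : Finset (Fin n)} (hS : S ∈ P) {i : Fin n} (hi : i ∈ S)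
    {c : Fin n → F} (hc : c ∈ C) (h : ∀ j ∈ S, j ≠ i → c j = 0) : c i = 0 := by
  obtain ⟨x, hx, -, -, hxS⟩ := hP.1 S hS
  have h1 := hx c hc
  rw [Finset.sum_eq_single i] at h1
  · have : x i ≠ 0 := by
      rw [← hxS] at hi
      simpa using hi
    simpa [this] using h1
  · intro j _ hj
    by_cases hjS : j ∈ S
    · rw [h j hjS hj, mul_zero]
    · rw [← hxS] at hjS
      have : x j = 0 := by simpa using hjS
      rw [this, zero_mul]
  · simp

lemma aux_card_le {n r : ℕ} {C : Submodule F (Fin n → F)} {P : Finset (Finset (Fin n))}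
    (hP : IsRecoveryPartition C r P) {S : Finset (Fin n)} (hS : S ∈ P) : S.card ≤ r + 1 := by
  obtain ⟨x, -, -, hx, rfl⟩ := hP.1 S hS
  exact hx

lemma aux_nonempty {n r : ℕ} {C : Submodule F (Fin n → F)} {P : Finset (Finset (Fin n))}
    (hP : IsRecoveryPartition C r P) {S : Finset (Fin n)} (hS : S ∈ P) : S.Nonempty := by
  obtain ⟨x, -, hx, -, rfl⟩ := hP.1 S hS
  obtain ⟨i, hi⟩ := Function.ne_iff.1 hx
  exact ⟨i, by simpa using hi⟩

lemma aux_card_biUnion {n r : ℕ} {C : Submodule F (Fin n → F)} {P : Finset (Finset (Fin n))}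
    (hP : IsRecoveryPartition C r P) {E : Finset (Finset (Fin n))} (hE : E ⊆ P) :
    (E.biUnion id).card = ∑ S ∈ E, S.card :=
  Finset.card_biUnion (fun S hS T hT h => hP.2.1 S (hE hS) T (hE hT) h)

lemma aux_card_univ {n r : ℕ} {C : Submodule F (Fin n → F)} {P : Finset (Finset (Fin n))}
    (hP : IsRecoveryPartition C r P) : ∑ S ∈ P, S.card = n := by
  rw [← aux_card_biUnion hP (Finset.Subset.refl P)]
  have : P.biUnion id = Finset.univ := by
    ext i
    simpa using hP.2.2 i
  simp [this]

lemma aux_singleton {n r k : ℕ} {C : Submodule F (Fin n → F)} {P : Finset (Finset (Fin n))}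
    (hP : IsRecoveryPartition C r P) (hk : Module.finrank F ↥C = k)
    {E : Finset (Finset (Fin n))} (hE : E ⊆ P) (hEk : ∑ S ∈ E, S.card < k + E.card) :
    ∃ c ∈ C, c ≠ 0 ∧ hammingNorm c + k + E.card ≤ n + 1 := by
  classical
  have hne : ∀ S : Finset (Fin n), S ∈ E → ∃ i, i ∈ S := fun S hS => aux_nonempty hP (hE hS)
  have hnn : Nonempty (Fin n) := by
    rcases E.eq_empty_or_nonempty with h | ⟨S, hS⟩
    · subst h
      obtain ⟨c, -, hc, -⟩ := aux_exists_vanish C ∅ (by rw [hk]; simpa using hEk)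
      exact ⟨(Function.ne_iff.1 hc).choose⟩
    · exact ⟨(hne S hS).choose⟩
  choose! t ht using hne
  have htinj : Set.InjOn t E := by
    intro S hS T hT h
    by_contra hne
    have := Finset.disjoint_left.1 (hP.2.1 S (hE hS) T (hE hT) hne) (ht S hS)
    rw [h] at this
    exact this (ht T hT)
  set T := E.image t with hT
  have hTc : T.card = E.card := Finset.card_image_of_injOn htinj
  set U := E.biUnion id with hU
  have hTU : T ⊆ U := by
    intro i hi
    obtain ⟨S, hS, rfl⟩ := Finset.mem_image.1 hi
    exact Finset.mem_biUnion.2 ⟨S, hS, ht S hS⟩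
  have hUc : U.card = ∑ S ∈ E, S.card := aux_card_biUnion hP hE
  have hW0 : (U \ T).card + E.card = U.card := by
    rw [← hTc]; exact Finset.card_sdiff_add_card_eq_card hTU
  have hTn : (univ \ T).card + E.card = n := by
    rw [← hTc, Finset.card_sdiff_add_card_eq_card (Finset.subset_univ T)]; simp
  -- vanishing on a set containing `U \ T` forces vanishing on `T`
  have key : ∀ c ∈ C, ∀ W : Finset (Fin n), U \ T ⊆ W → (∀ i ∈ W, c i = 0) →
      ∀ i ∈ T, c i = 0 := by
    intro c hc W hW h i hi
    obtain ⟨S, hS, rfl⟩ := Finset.mem_image.1 hi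
    apply aux_recover hP (hE hS) (ht S hS) hc
    intro j hj hne
    apply h j (hW _)
    rw [Finset.mem_sdiff]
    refine ⟨Finset.mem_biUnion.2 ⟨S, hS, hj⟩, ?_⟩
    intro hjT
    obtain ⟨S', hS', hS'j⟩ := Finset.mem_image.1 hjT
    by_cases hSS : S = S'
    · subst hSS; exact hne hS'j.symm
    · have := Finset.disjoint_left.1 (hP.2.1 S (hE hS) S' (hE hS') hSS) hj
      rw [← hS'j] at this
      exact this (ht S' hS')
  have hsub : U \ T ⊆ univ \ T := Finset.sdiff_subset_sdiff (Finset.subset_univ _) (le_refl _)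
  by_cases hbig : k - 1 ≤ (univ \ T).card
  · obtain ⟨W, hW1, hW2, hW3⟩ := Finset.exists_subsuperset_card_eq hsub
      (show (U \ T).card ≤ k - 1 by omega) hbig
    obtain ⟨c, hc, hc0, hcW⟩ := aux_exists_vanish C W (by omega)
    refine ⟨c, hc, hc0, ?_⟩
    have hcT := key c hc W hW1 hcW
    have hdisj : Disjoint W T := by
      rw [Finset.disjoint_left]
      intro i hi hiT
      exact (Finset.mem_sdiff.1 (hW2 hi)).2 hiT
    have hle : hammingNorm c ≤ (univ \ (W ∪ T)).card := by
      apply Finset.card_le_card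
      intro i hi
      simp only [Finset.mem_filter, Finset.mem_univ, true_and] at hi
      simp only [Finset.mem_sdiff, Finset.mem_univ, true_and, Finset.mem_union, not_or]
      exact ⟨fun h => hi (hcW i h), fun h => hi (hcT i h)⟩
    have h2 := Finset.card_sdiff_add_card_eq_card (Finset.subset_univ (W ∪ T))
    rw [Finset.card_union_of_disjoint hdisj, Finset.card_univ, Fintype.card_fin] at h2
    omega
  · exfalso
    obtain ⟨c, hc, hc0, hcW⟩ := aux_exists_vanish C (univ \ T) (by omega)
    have hcT := key c hc _ hsub hcW
    apply hc0
    funext i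
    by_cases hi : i ∈ T
    · exact hcT i hi
    · exact hcW i (by simp [hi])

lemma aux_dim {n r k : ℕ} {C : Submodule F (Fin n → F)} {P : Finset (Finset (Fin n))}
    (hP : IsRecoveryPartition C r P) (hk : Module.finrank F ↥C = k) : k ≤ P.card * r := by
  have hn := aux_card_univ hP
  have h1 : ∑ S ∈ P, S.card ≤ P.card * (r + 1) := by
    simpa using Finset.sum_le_card_nsmul P _ (r+1) (fun S hS => aux_card_le hP hS)
  by_contra hlt
  obtain ⟨c, hc, hc0, h⟩ := aux_singleton hP hk (Finset.Subset.refl P) (by nlinarith)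
  have := hammingNorm_pos_iff.2 hc0
  nlinarith

lemma aux_locality {n r : ℕ} {C : Submodule F (Fin n → F)} {P : Finset (Finset (Fin n))}
    (hP : IsRecoveryPartition C r P) : HasLocality C r := by
  intro i
  obtain ⟨S, hS, hi⟩ := hP.2.2 i
  refine ⟨S, aux_card_le hP hS, hi, fun u hu v hv h => ?_⟩
  have := aux_recover hP hS hi (C.sub_mem hu hv) (fun j hj hne => by
    simp [h j hj hne])
  exact sub_eq_zero.1 this

lemma aux_puncture {n m r k d s : ℕ} {C : Submodule F (Fin n → F)}
    {P : Finset (Finset (Fin n))}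
    (hP : IsRecoveryPartition C r P) (hk : Module.finrank F ↥C = k)
    (hd : ∀ c ∈ C, c ≠ 0 → d ≤ hammingNorm c)
    {Q : Finset (Finset (Fin n))} (hQ : Q ⊆ P) (hQs : ∑ S ∈ Q, S.card = s) (hsd : s < d)
    (hm : m + s = n) :
    ∃ C' : Submodule F (Fin m → F), Module.finrank F ↥C' = k ∧
      (∀ c ∈ C', c ≠ 0 → d - s ≤ hammingNorm c) ∧ ∃ P', IsRecoveryPartition C' r P' := by
  classical
  set U := Q.biUnion id with hU
  have hUc : U.card = s := by rw [← hQs]; exact aux_card_biUnion hP hQ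
  have hJ : (univ \ U).card = m := by
    have := Finset.card_sdiff_add_card_eq_card (Finset.subset_univ U)
    rw [Finset.card_univ, Fintype.card_fin] at this
    omega
  let e : Fin m ↪ Fin n := ((univ \ U).orderEmbOfFin hJ).toEmbedding
  have he : ∀ j, (∃ i, e i = j) ↔ j ∉ U := by
    intro j
    have := Finset.range_orderEmbOfFin (univ \ U) hJ
    have h2 := Set.ext_iff.1 this j
    simp only [Set.mem_range, Finset.coe_sdiff, Finset.coe_univ, Set.mem_sdiff, Set.mem_univ, true_and, Finset.mem_coe] at h2
    exact h2
  let f : (Fin n → F) →ₗ[F] (Fin m → F) := LinearMap.funLeft F F e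
  have hf : ∀ c i, f c i = c (e i) := fun c i => rfl
  have hnorm : ∀ c : Fin n → F, hammingNorm c ≤ hammingNorm (f c) + s := by
    intro c
    rw [← hUc]
    calc hammingNorm c ≤ (((univ.filter fun i => f c i ≠ 0).map e) ∪ U).card := by
          apply Finset.card_le_card
          intro j hj
          simp only [Finset.mem_filter, Finset.mem_univ, true_and] at hj
          by_cases hjU : j ∈ U
          · exact Finset.mem_union_right _ hjU
          · obtain ⟨i, rfl⟩ := (he j).2 hjU
            apply Finset.mem_union_left
            apply Finset.mem_map_of_mem
            simpa [hf] using hj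
      _ ≤ _ := by
          refine (Finset.card_union_le _ _).trans ?_
          rw [Finset.card_map]
          exact le_refl _
  have hpos : ∀ c ∈ C, c ≠ 0 → f c ≠ 0 := by
    intro c hc hc0 h
    have h1 := hnorm c
    rw [h, hammingNorm_zero] at h1
    have := hd c hc hc0
    omega
  refine ⟨C.map f, ?_, ?_, ?_⟩
  · rw [← hk, ← LinearMap.range_domRestrict]
    apply LinearMap.finrank_range_of_inj
    rw [← LinearMap.ker_eq_bot, LinearMap.ker_eq_bot']
    intro x hx
    by_contra hne
    exact hpos x x.2 (fun h => hne (Subtype.ext h)) hx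
  · rintro _ ⟨c, hc, rfl⟩ hne
    have h1 := hnorm c
    have := hd c hc (by rintro rfl; simp at hne)
    omega
  · refine ⟨(P \ Q).image (fun S => univ.filter fun i => e i ∈ S), ?_, ?_, ?_⟩
    · intro S' hS'
      obtain ⟨S, hS, rfl⟩ := Finset.mem_image.1 hS'
      obtain ⟨hSP, hSQ⟩ := Finset.mem_sdiff.1 hS
      obtain ⟨x, hx, hx0, hxr, hxS⟩ := hP.1 S hSP
      have hSU : ∀ j ∈ S, j ∉ U := by
        intro j hj hjU
        obtain ⟨T, hT, hjT⟩ := Finset.mem_biUnion.1 hjU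
        have hne : S ≠ T := by rintro rfl; exact hSQ hT
        exact Finset.disjoint_left.1 (hP.2.1 S hSP T (hQ hT) hne) hj hjT
      have hxm : ∀ j, x j ≠ 0 ↔ j ∈ S := by
        intro j; rw [← hxS]; simp
      refine ⟨f x, ?_, ?_, ?_, ?_⟩
      · rintro _ ⟨c, hc, rfl⟩
        rw [← hx c hc]
        have : ∑ i, f x i * f c i = ∑ j ∈ univ.map e, x j * c j := by
          rw [Finset.sum_map]; rfl
        rw [this]
        apply Finset.sum_subset (Finset.subset_univ _)
        intro j _ hj
        have : x j = 0 := by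
          by_contra h
          obtain ⟨i, hi⟩ := (he j).2 (hSU j ((hxm j).1 h))
          exact hj (by simpa using ⟨i, hi⟩)
        rw [this, zero_mul]
      · obtain ⟨j, hj⟩ := Function.ne_iff.1 hx0
        obtain ⟨i, rfl⟩ := (he j).2 (hSU j ((hxm j).1 hj))
        intro h
        exact hj (congrFun h i)
      · refine le_trans ?_ hxr
        have : ((univ.filter fun i => f x i ≠ 0).map e).card ≤ hammingNorm x := by
          apply Finset.card_le_card
          intro j hj
          obtain ⟨i, hi, rfl⟩ := Finset.mem_map.1 hj
          simpa [hf] using hi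
        rwa [Finset.card_map] at this
      · ext i
        simpa [hf] using hxm (e i)
    · intro S' hS' T' hT' hne
      obtain ⟨S, hS, rfl⟩ := Finset.mem_image.1 hS'
      obtain ⟨T, hT, rfl⟩ := Finset.mem_image.1 hT'
      have hST : S ≠ T := by rintro rfl; exact hne rfl
      have := hP.2.1 S (Finset.mem_sdiff.1 hS).1 T (Finset.mem_sdiff.1 hT).1 hST
      rw [Finset.disjoint_left]
      intro i hi hi'
      simp only [Finset.mem_filter, Finset.mem_univ, true_and] at hi hi'
      exact Finset.disjoint_left.1 this hi hi'
    · intro i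
      obtain ⟨S, hS, hi⟩ := hP.2.2 (e i)
      refine ⟨univ.filter fun i => e i ∈ S, Finset.mem_image_of_mem _ ?_, by simpa using hi⟩
      rw [Finset.mem_sdiff]
      refine ⟨hS, fun hSQ => ?_⟩
      exact (he (e i)).1 ⟨i, rfl⟩ (Finset.mem_biUnion.2 ⟨S, hSQ, hi⟩)

end Helpers

set_option maxHeartbeats 1000000 in
/-- Corollary 4.3: from a `q`-ary Singleton-optimal `[n,k,d;r]`-LRC
with disjoint recovery sets, `r < k`, `r² + 2r < n - d`, and `d ≡ b (mod r+1)` with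
`1 ≤ b ≤ r+1`, one obtains a `q`-ary Singleton-optimal `[n-d+b, k, b; r]`-LRC with
disjoint recovery sets. -/
theorem optLRC_reduction {F : Type*} [Field F] [Fintype F] [DecidableEq F]
    {n k d r b : ℕ} (C : Submodule F (Fin n → F))
    (hC : IsOptLRC C k d r)
    (hdis : HasDisjointRecoverySets C r)
    (hrk : r < k)
    (hn : (r : ℤ) ^ 2 + 2 * (r : ℤ) < (n : ℤ) - (d : ℤ))
    (hb1 : 1 ≤ b) (hb2 : b ≤ r + 1) (hdb : d ≡ b [MOD r + 1]) :
    ∃ C' : Submodule F (Fin (n - d + b) → F),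
      IsOptLRC C' k b r ∧ HasDisjointRecoverySets C' r := by
  classical
  obtain ⟨hk, ⟨⟨c0, hc0, hc0n, hc0d⟩, hd⟩, -, hopt⟩ := hC
  obtain ⟨P, hP⟩ := hdis
  have hkP := aux_dim hP hk
  have hr : 0 < r := by
    rcases Nat.eq_zero_or_pos r with h | h
    · subst h; omega
    · exact h
  have hdpos : 0 < d := by rw [← hc0d]; exact hammingNorm_pos_iff.2 hc0n
  have hdn : d ≤ n := by
    rw [← hc0d]; simpa using hammingNorm_le_card_fintype (x := c0)
  obtain ⟨K, hK, hK1, hK2⟩ : ∃ K : ℕ, ⌈(k : ℚ) / (r : ℚ)⌉ = (K : ℤ) ∧ k ≤ K * r ∧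
      K * r < k + r := by
    have hrq : (0 : ℚ) < r := by exact_mod_cast hr
    have h0 : (0 : ℚ) ≤ (k : ℚ) / r := by positivity
    refine ⟨⌈(k : ℚ) / (r : ℚ)⌉₊, ?_, ?_, ?_⟩
    · exact (Int.natCast_ceil_eq_ceil h0).symm
    · have := Nat.le_ceil ((k : ℚ) / r)
      rw [div_le_iff₀ hrq] at this
      exact_mod_cast this
    · have := Nat.ceil_lt_add_one h0
      have h2 := mul_lt_mul_of_pos_right this hrq
      rw [add_mul, div_mul_cancel₀ _ hrq.ne', one_mul] at h2
      exact_mod_cast h2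
  unfold SingletonOptimalParams at hopt
  have hopt' : d + k + K = n + 2 := by rw [hK] at hopt; omega
  have hn' : r * r + 2 * r + d < n := by
    have : ((r * r + 2 * r + d : ℕ) : ℤ) < (n : ℤ) := by push_cast; nlinarith
    exact_mod_cast this
  have hKP : K ≤ P.card := by
    by_contra h
    have : (P.card + 1) * r ≤ K * r := Nat.mul_le_mul_right r (by omega)
    nlinarith
  have hrK : r ≤ K := by
    by_contra h
    have : K * r ≤ r * r := Nat.mul_le_mul_right r (by omega)
    omega
  -- deficient sets
  set D := P.filter (fun S => ¬ S.card = r + 1) with hD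
  set G := P.filter (fun S => S.card = r + 1) with hG
  have hDle : ∀ S ∈ D, S.card ≤ r := by
    intro S hS
    obtain ⟨h1, h2⟩ := Finset.mem_filter.1 hS
    have := aux_card_le hP h1
    omega
  have hDP : D ⊆ P := Finset.filter_subset _ _
  have hGP : G ⊆ P := Finset.filter_subset _ _
  have hDr : D.card < r := by
    by_contra h
    obtain ⟨D0, hD0, hD0c⟩ := Finset.exists_subset_card_eq (not_lt.1 h)
    obtain ⟨E, hE1, hE2, hE3⟩ := Finset.exists_subsuperset_card_eq (hD0.trans hDP)
      (show D0.card ≤ K by omega) hKP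
    have hs := Finset.sum_sdiff (f := fun S : Finset (Fin n) => S.card) hE1
    have h1 : ∑ S ∈ D0, S.card ≤ D0.card * r := by
      simpa using Finset.sum_le_card_nsmul D0 _ r (fun S hS => hDle S (hD0 hS))
    have h2 : ∑ S ∈ E \ D0, S.card ≤ (E \ D0).card * (r + 1) := by
      simpa using Finset.sum_le_card_nsmul (E \ D0) _ (r + 1)
        (fun S hS => aux_card_le hP (hE2 (Finset.mem_sdiff.1 hS).1))
    have h3 := Finset.card_sdiff_add_card_eq_card hE1
    obtain ⟨c, hc, hcn, h4⟩ := aux_singleton hP hk hE2 (by nlinarith)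
    have := hd c hc hcn
    omega
  obtain ⟨a, ha⟩ : ∃ a, d = a * (r + 1) + b := by
    have hbd : b ≤ d := by
      by_contra h
      have h1 := (Nat.modEq_iff_dvd' (by omega)).1 hdb
      have := Nat.le_of_dvd (by omega) h1
      omega
    obtain ⟨a, ha⟩ := (Nat.modEq_iff_dvd' hbd).1 hdb.symm
    exact ⟨a, by rw [mul_comm]; omega⟩
  have haG : a ≤ G.card := by
    have hs := Finset.sum_filter_add_sum_filter_not P (fun S => S.card = r + 1)
      (fun S : Finset (Fin n) => S.card)
    rw [aux_card_univ hP] at hs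
    change ∑ S ∈ G, S.card + ∑ S ∈ D, S.card = n at hs
    have h1 : ∑ S ∈ D, S.card ≤ D.card * r := by
      simpa using Finset.sum_le_card_nsmul D _ r hDle
    have h2 : ∑ S ∈ G, S.card = G.card * (r + 1) := by
      simpa using Finset.sum_const_nat (s := G) (m := r + 1)
        (fun S hS => (Finset.mem_filter.1 hS).2)
    have h3 : D.card * r ≤ r * r := Nat.mul_le_mul_right r hDr.le
    have h4 : a * (r + 1) ≤ G.card * (r + 1) := by omega
    exact Nat.le_of_mul_le_mul_right h4 (by omega)
  obtain ⟨Q, hQG, hQc⟩ := Finset.exists_subset_card_eq haG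
  have hQs : ∑ S ∈ Q, S.card = a * (r + 1) := by
    rw [← hQc]
    exact Finset.sum_const_nat (fun S hS => (Finset.mem_filter.1 (hQG hS)).2)
  obtain ⟨C', hk', hd', P', hP'⟩ := aux_puncture (m := n - d + b) hP hk hd (hQG.trans hGP) hQs
    (by omega) (by omega)
  have hdb' : d - a * (r + 1) = b := by omega
  rw [hdb'] at hd'
  refine ⟨C', ⟨hk', ⟨?_, hd'⟩, aux_locality hP', ?_⟩, P', hP'⟩
  · have hkP' := aux_dim hP' hk'
    have hKP' : K ≤ P'.card := by
      by_contra h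
      have : (P'.card + 1) * r ≤ K * r := Nat.mul_le_mul_right r (by omega)
      nlinarith
    obtain ⟨E, hE, hEc⟩ := Finset.exists_subset_card_eq (show K - 1 ≤ P'.card by omega)
    have h2 : ∑ S ∈ E, S.card ≤ E.card * (r + 1) := by
      simpa using Finset.sum_le_card_nsmul E _ (r + 1) (fun S hS => aux_card_le hP' (hE hS))
    have hEK : E.card + 1 = K := by omega
    have hlt : ∑ S ∈ E, S.card < k + E.card := by
      have h3 := hK2
      rw [← hEK, add_mul, one_mul] at h3
      rw [mul_add, mul_one] at h2
      linarith
    obtain ⟨c, hc, hcn, h4⟩ := aux_singleton hP' hk' hE hlt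
    have := hd' c hc hcn
    exact ⟨c, hc, hcn, by omega⟩
  · unfold SingletonOptimalParams
    rw [hK]
    omega
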